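/- arXiv:1103.1334 — 5 statements merged into one kernel-verified Lean document; each statement's English description precedes it below -/
import Mathlib

section
/- Soundness of the binary sequent calculus G for truth-invariance semantics: if a sequent Φ ⊢ Ψ is derivable in G from a set Γ of assumption sequents, then every many-valued valuation v that satisfies all sequents of Γ also satisfies Φ ⊢ Ψ, i.e. 𝔉(v)(Φ) ≤ 𝔉(v)(Ψ). -/
/-- Propositional formulas of the many-valued logic `L`, generated from atoms in `H`
by unary connectives indexed by `U` and binary connectives indexed by `B`. -/
inductive Fml (H U B : Type) : Type
  | atom : H → Fml H U B
  | un : U → Fml H U B → Fml H U B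
  | bin : B → Fml H U B → Fml H U B → Fml H U B

/-- The multi-modal 2-valued language `L_M`. -/
inductive MFml (X H U B : Type) : Type
  | bot : MFml X H U B
  | top : MFml X H U B
  | box : X → Fml H U B → MFml X H U B
  | bbox : Bool → MFml X H U B → MFml X H U B
  | and : MFml X H U B → MFml X H U B → MFml X H U B
  | or : MFml X H U B → MFml X H U B → MFml X H U B

variable {X H U B : Type}

/-- Homomorphic extension of a many-valued valuation `v : H → X` to all formulas,
where the unary connective `u` is interpreted by `su u` and the binary connective
`c` by `bo c`. -/
def mvVal (su : U → X → X) (bo : B → X → X → X) (v : H → X) : Fml H U B → X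
  | .atom a => v a
  | .un u φ => su u (mvVal su bo v φ)
  | .bin c φ ψ => bo c (mvVal su bo v φ) (mvVal su bo v ψ)

/-- The modal valuation `𝔉(v) : L_M → 2`. -/
def mval [DecidableEq X] (su : U → X → X) (bo : B → X → X → X) (v : H → X) :
    MFml X H U B → Bool
  | .bot => false
  | .top => true
  | .box x φ => decide (mvVal su bo v φ = x)
  | .bbox b Φ => decide (mval su bo v Φ = b)
  | .and Φ Ψ => mval su bo v Φ && mval su bo v Ψ
  | .or Φ Ψ => mval su bo v Φ || mval su bo v Ψ

/-- Finite disjunction (empty disjunction is `0`). -/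
def bigOr : List (MFml X H U B) → MFml X H U B
  | [] => .bot
  | Φ :: l => .or Φ (bigOr l)

/-- Finite conjunction (empty conjunction is `1`). -/
def bigAnd : List (MFml X H U B) → MFml X H U B
  | [] => .top
  | Φ :: l => .and Φ (bigAnd l)

/-- `⋁_{y ∈ X : x = s(y)} [y]φ`. -/
noncomputable def unDisj [Fintype X] [DecidableEq X] (su : U → X → X) (x : X) (u : U)
    (φ : Fml H U B) : MFml X H U B :=
  bigOr (((Finset.univ.filter fun y => x = su u y)).toList.map fun y => .box y φ)

/-- `⋁_{(y,z) ∈ X×X : x = o(y,z)} ([y]φ ∧ [z]ψ)`. -/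
noncomputable def binDisj [Fintype X] [DecidableEq X] (bo : B → X → X → X) (x : X) (c : B)
    (φ ψ : Fml H U B) : MFml X H U B :=
  bigOr (((Finset.univ.filter fun p : X × X => x = bo c p.1 p.2)).toList.map
    fun p => .and (.box p.1 φ) (.box p.2 ψ))

/-- `⋁_{(b1,b2) ∈ 2×2 : b = op(b1,b2)} ([b1]Φ ∧ [b2]Ψ)`. -/
noncomputable def boolDisj (op : Bool → Bool → Bool) (b : Bool) (Φ Ψ : MFml X H U B) : MFml X H U B :=
  bigOr (((Finset.univ.filter fun p : Bool × Bool => b = op p.1 p.2)).toList.map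
    fun p => .and (.bbox p.1 Φ) (.bbox p.2 Ψ))

/-- The derivability relation `Γ ⊩ (Φ ⊢ Ψ)` of the Gentzen system `G`. -/
inductive Deriv [Fintype X] [DecidableEq X] (su : U → X → X) (bo : B → X → X → X)
    (Γ : Set (MFml X H U B × MFml X H U B)) : MFml X H U B → MFml X H U B → Prop
  | hyp {Φ Ψ} : (Φ, Ψ) ∈ Γ → Deriv su bo Γ Φ Ψ
  | refl (Φ) : Deriv su bo Γ Φ Φ
  | top (Φ) : Deriv su bo Γ Φ .top
  | bot (Φ) : Deriv su bo Γ .bot Φ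
  | andE1 (Φ Ψ) : Deriv su bo Γ (.and Φ Ψ) Φ
  | andE2 (Φ Ψ) : Deriv su bo Γ (.and Φ Ψ) Ψ
  | orI1 (Φ Ψ) : Deriv su bo Γ Φ (.or Φ Ψ)
  | orI2 (Φ Ψ) : Deriv su bo Γ Φ (.or Ψ Φ)
  | distrib (Φ Ψ Υ) :
      Deriv su bo Γ (.and Φ (.or Ψ Υ)) (.or (.and Φ Ψ) (.and Φ Υ))
  | introBoolAnd (b Φ Ψ) :
      Deriv su bo Γ (boolDisj (· && ·) b Φ Ψ) (.bbox b (.and Φ Ψ))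
  | introBoolOr (b Φ Ψ) :
      Deriv su bo Γ (boolDisj (· || ·) b Φ Ψ) (.bbox b (.or Φ Ψ))
  | introUn (x u φ) : Deriv su bo Γ (unDisj su x u φ) (.box x (.un u φ))
  | introBin (x c φ ψ) : Deriv su bo Γ (binDisj bo x c φ ψ) (.box x (.bin c φ ψ))
  | elimBoolAnd (b Φ Ψ) :
      Deriv su bo Γ (.bbox b (.and Φ Ψ)) (boolDisj (· && ·) b Φ Ψ)
  | elimBoolOr (b Φ Ψ) :
      Deriv su bo Γ (.bbox b (.or Φ Ψ)) (boolDisj (· || ·) b Φ Ψ)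
  | elimUn (x u φ) : Deriv su bo Γ (.box x (.un u φ)) (unDisj su x u φ)
  | elimBin (x c φ ψ) : Deriv su bo Γ (.box x (.bin c φ ψ)) (binDisj bo x c φ ψ)
  | cut {Φ Ψ Υ} : Deriv su bo Γ Φ Ψ → Deriv su bo Γ Ψ Υ → Deriv su bo Γ Φ Υ
  | lowerBound {Φ Ψ Υ} :
      Deriv su bo Γ Φ Ψ → Deriv su bo Γ Φ Υ → Deriv su bo Γ Φ (.and Ψ Υ)
  | upperBound {Φ Ψ Υ} :
      Deriv su bo Γ Φ Ψ → Deriv su bo Γ Υ Ψ → Deriv su bo Γ (.or Φ Υ) Ψ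

/-- Formulas of `L_M` with no nested modal operators. -/
inductive NoNest : MFml X H U B → Prop
  | bot : NoNest .bot
  | top : NoNest .top
  | box (x φ) : NoNest (.box x φ)
  | and {Φ Ψ} : NoNest Φ → NoNest Ψ → NoNest (.and Φ Ψ)
  | or {Φ Ψ} : NoNest Φ → NoNest Ψ → NoNest (.or Φ Ψ)

/-- The canonical reduct of `[x]φ` (Definition 3 of the paper). -/
noncomputable def reduct [Fintype X] [DecidableEq X] (su : U → X → X) (bo : B → X → X → X) :
    Fml H U B → X → MFml X H U B
  | .atom A, x => .box x (.atom A)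
  | .un u φ, x =>
      bigOr (((Finset.univ.filter fun y => x = su u y)).toList.map
        fun y => reduct su bo φ y)
  | .bin c φ ψ, x =>
      bigOr (((Finset.univ.filter fun p : X × X => x = bo c p.1 p.2)).toList.map
        fun p => .and (reduct su bo φ p.1) (reduct su bo ψ p.2))

/-- Homomorphic extension of a substitution `σ : H → L` to `L`. -/
def subFml (σ : H → Fml H U B) : Fml H U B → Fml H U B
  | .atom A => σ A
  | .un u φ => .un u (subFml σ φ)
  | .bin c φ ψ => .bin c (subFml σ φ) (subFml σ ψ)

/-- Extension `σ_M : L_M → L_M` of a substitution. -/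
def subM (σ : H → Fml H U B) : MFml X H U B → MFml X H U B
  | .bot => .bot
  | .top => .top
  | .box x φ => .box x (subFml σ φ)
  | .bbox b Φ => .bbox b (subM σ Φ)
  | .and Φ Ψ => .and (subM σ Φ) (subM σ Ψ)
  | .or Φ Ψ => .or (subM σ Φ) (subM σ Ψ)

/-- Satisfaction at a possible world of the autoreferential Kripke model
(worlds `W = X ⊕ 2`, accessibility `R_u = W × {u}`). -/
def sat (su : U → X → X) (bo : B → X → X → X) (v : H → X) :
    (X ⊕ Bool) → MFml X H U B → Prop
  | _, .bot => False
  | _, .top => True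
  | _, .box x φ => mvVal su bo v φ = x
  | _, .bbox b Φ => sat su bo v (Sum.inr b) Φ
  | w, .and Φ Ψ => sat su bo v w Φ ∧ sat su bo v w Ψ
  | w, .or Φ Ψ => sat su bo v w Φ ∨ sat su bo v w Ψ

/-- The sequent bivaluation `𝔅(v)`. -/
def biv [DecidableEq X] (su : U → X → X) (bo : B → X → X → X) (v : H → X)
    (s : MFml X H U B × MFml X H U B) : Bool :=
  decide (mval su bo v s.1 = (mval su bo v s.1 && mval su bo v s.2))

/-- Modal literal `[y₁]…[y_{k-1}][x]A`. -/
def modalLit (l : List Bool) (x : X) (A : H) : MFml X H U B :=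
  l.foldr (fun b Φ => MFml.bbox b Φ) (MFml.box x (Fml.atom A))

/-- The theory `T_v` determined by a many-valued valuation `v`. -/
def Tv (v : H → X) : Set (MFml X H U B × MFml X H U B) :=
  {s | ∃ (A : H) (x : X), v A = x ∧
      (s = (MFml.top, MFml.box x (Fml.atom A)) ∨
       s = (MFml.box x (Fml.atom A), MFml.top))} ∪
  {s | ∃ (A : H) (x : X), v A ≠ x ∧
      (s = (MFml.box x (Fml.atom A), MFml.bot) ∨
       s = (MFml.bot, MFml.box x (Fml.atom A)))}

/-- The derivability relation of the Gentzen system `G` extended with the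
substitution rule. -/
inductive DerivS [Fintype X] [DecidableEq X] (su : U → X → X) (bo : B → X → X → X)
    (Γ : Set (MFml X H U B × MFml X H U B)) : MFml X H U B → MFml X H U B → Prop
  | hyp {Φ Ψ} : (Φ, Ψ) ∈ Γ → DerivS su bo Γ Φ Ψ
  | refl (Φ) : DerivS su bo Γ Φ Φ
  | top (Φ) : DerivS su bo Γ Φ .top
  | bot (Φ) : DerivS su bo Γ .bot Φ
  | andE1 (Φ Ψ) : DerivS su bo Γ (.and Φ Ψ) Φ
  | andE2 (Φ Ψ) : DerivS su bo Γ (.and Φ Ψ) Ψ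
  | orI1 (Φ Ψ) : DerivS su bo Γ Φ (.or Φ Ψ)
  | orI2 (Φ Ψ) : DerivS su bo Γ Φ (.or Ψ Φ)
  | distrib (Φ Ψ Υ) :
      DerivS su bo Γ (.and Φ (.or Ψ Υ)) (.or (.and Φ Ψ) (.and Φ Υ))
  | introBoolAnd (b Φ Ψ) :
      DerivS su bo Γ (boolDisj (· && ·) b Φ Ψ) (.bbox b (.and Φ Ψ))
  | introBoolOr (b Φ Ψ) :
      DerivS su bo Γ (boolDisj (· || ·) b Φ Ψ) (.bbox b (.or Φ Ψ))
  | introUn (x u φ) : DerivS su bo Γ (unDisj su x u φ) (.box x (.un u φ))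
  | introBin (x c φ ψ) : DerivS su bo Γ (binDisj bo x c φ ψ) (.box x (.bin c φ ψ))
  | elimBoolAnd (b Φ Ψ) :
      DerivS su bo Γ (.bbox b (.and Φ Ψ)) (boolDisj (· && ·) b Φ Ψ)
  | elimBoolOr (b Φ Ψ) :
      DerivS su bo Γ (.bbox b (.or Φ Ψ)) (boolDisj (· || ·) b Φ Ψ)
  | elimUn (x u φ) : DerivS su bo Γ (.box x (.un u φ)) (unDisj su x u φ)
  | elimBin (x c φ ψ) : DerivS su bo Γ (.box x (.bin c φ ψ)) (binDisj bo x c φ ψ)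
  | cut {Φ Ψ Υ} : DerivS su bo Γ Φ Ψ → DerivS su bo Γ Ψ Υ → DerivS su bo Γ Φ Υ
  | lowerBound {Φ Ψ Υ} :
      DerivS su bo Γ Φ Ψ → DerivS su bo Γ Φ Υ → DerivS su bo Γ Φ (.and Ψ Υ)
  | upperBound {Φ Ψ Υ} :
      DerivS su bo Γ Φ Ψ → DerivS su bo Γ Υ Ψ → DerivS su bo Γ (.or Φ Υ) Ψ
  | subst {Φ Ψ} (σ : H → Fml H U B) :
      DerivS su bo Γ Φ Ψ → DerivS su bo Γ (subM σ Φ) (subM σ Ψ)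

theorem mval_bigOr [DecidableEq X] (su : U → X → X) (bo : B → X → X → X) (v : H → X)
    (l : List (MFml X H U B)) :
    mval su bo v (bigOr l) = true ↔ ∃ Φ ∈ l, mval su bo v Φ = true := by
  induction l with
  | nil => simp [bigOr, mval]
  | cons Φ l ih => simp [bigOr, mval, ih]

/-- The disjunction of the unary rules has the same value as the modal atom it unfolds. -/
theorem mval_unDisj [Fintype X] [DecidableEq X] (su : U → X → X) (bo : B → X → X → X)
    (v : H → X) (x : X) (u : U) (φ : Fml H U B) :
    mval su bo v (unDisj su x u φ) = mval su bo v (.box x (.un u φ)) := by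
  rw [Bool.eq_iff_iff, unDisj, mval_bigOr]
  simp only [List.mem_map, Finset.mem_toList, Finset.mem_filter, Finset.mem_univ, true_and,
    exists_exists_and_eq_and, mval, decide_eq_true_eq]
  constructor
  · rintro ⟨y, hy, h⟩
    rw [mvVal, h, hy]
  · intro h
    exact ⟨_, h.symm, rfl⟩

/-- The disjunction of the binary rules has the same value as the modal atom it unfolds. -/
theorem mval_binDisj [Fintype X] [DecidableEq X] (su : U → X → X) (bo : B → X → X → X)
    (v : H → X) (x : X) (c : B) (φ ψ : Fml H U B) :
    mval su bo v (binDisj bo x c φ ψ) = mval su bo v (.box x (.bin c φ ψ)) := by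
  rw [Bool.eq_iff_iff, binDisj, mval_bigOr]
  simp only [List.mem_map, Finset.mem_toList, Finset.mem_filter, Finset.mem_univ, true_and,
    exists_exists_and_eq_and, mval, Bool.and_eq_true, decide_eq_true_eq]
  constructor
  · rintro ⟨p, hp, h₁, h₂⟩
    rw [mvVal, h₁, h₂, hp]
  · intro h
    exact ⟨(_, _), h.symm, rfl, rfl⟩

theorem mval_boolDisj [DecidableEq X] (su : U → X → X) (bo : B → X → X → X)
    (v : H → X) (op : Bool → Bool → Bool) (b : Bool) (Φ Ψ : MFml X H U B) :
    mval su bo v (boolDisj op b Φ Ψ) =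
      decide (op (mval su bo v Φ) (mval su bo v Ψ) = b) := by
  rw [Bool.eq_iff_iff, boolDisj, mval_bigOr]
  simp only [List.mem_map, Finset.mem_toList, Finset.mem_filter, Finset.mem_univ, true_and,
    exists_exists_and_eq_and, mval, Bool.and_eq_true, decide_eq_true_eq]
  constructor
  · rintro ⟨p, hp, h₁, h₂⟩
    rw [h₁, h₂, hp]
  · intro h
    exact ⟨(_, _), h.symm, rfl, rfl⟩

/-- Soundness of the binary sequent calculus `G` for the
truth-invariance semantics. -/
theorem soundness_of_G [Fintype X] [DecidableEq X]
    (su : U → X → X) (bo : B → X → X → X)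
    (Γ : Set (MFml X H U B × MFml X H U B)) (Φ Ψ : MFml X H U B)
    (h : Deriv su bo Γ Φ Ψ) :
    ∀ v : H → X, (∀ s ∈ Γ, mval su bo v s.1 ≤ mval su bo v s.2) →
      mval su bo v Φ ≤ mval su bo v Ψ := by
  intro v hΓ
  induction h with
  | hyp h => exact hΓ _ h
  | refl => exact le_rfl
  | top => exact le_top
  | bot => exact bot_le
  | andE1 => exact inf_le_left
  | andE2 => exact inf_le_right
  | orI1 => exact le_sup_left
  | orI2 => exact le_sup_right
  | distrib => exact inf_sup_left _ _ _ |>.le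
  | introBoolAnd => exact (mval_boolDisj su bo v _ _ _ _).le
  | introBoolOr => exact (mval_boolDisj su bo v _ _ _ _).le
  | introUn => exact (mval_unDisj su bo v _ _ _).le
  | introBin => exact (mval_binDisj su bo v _ _ _ _).le
  | elimBoolAnd => exact (mval_boolDisj su bo v _ _ _ _).ge
  | elimBoolOr => exact (mval_boolDisj su bo v _ _ _ _).ge
  | elimUn => exact (mval_unDisj su bo v _ _ _).ge
  | elimBin => exact (mval_binDisj su bo v _ _ _ _).ge
  | cut _ _ ih₁ ih₂ => exact ih₁.trans ih₂
  | lowerBound _ _ ih₁ ih₂ => exact le_inf ih₁ ih₂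
  | upperBound _ _ ih₁ ih₂ => exact sup_le ih₁ ih₂
end

section
/- Theorems of G with substitution are tautologies: if a sequent s is derivable from the empty set of assumptions in the system G extended with the substitution rule (from Φ ⊢ Ψ infer σ_M(Φ) ⊢ σ_M(Ψ), for any substitution σ), then s is a tautology, i.e. every many-valued valuation satisfies s. -/
variable {X H U B : Type}

theorem mvVal_subFml (su : U → X → X) (bo : B → X → X → X) (v : H → X)
    (σ : H → Fml H U B) (φ : Fml H U B) :
    mvVal su bo v (subFml σ φ) = mvVal su bo (fun a => mvVal su bo v (σ a)) φ := by
  induction φ with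
  | atom a => rfl
  | un u φ ih => simp only [subFml, mvVal, ih]
  | bin c φ ψ ihφ ihψ => simp only [subFml, mvVal, ihφ, ihψ]

theorem mval_subM [DecidableEq X] (su : U → X → X) (bo : B → X → X → X) (v : H → X)
    (σ : H → Fml H U B) (Φ : MFml X H U B) :
    mval su bo v (subM σ Φ) = mval su bo (fun a => mvVal su bo v (σ a)) Φ := by
  induction Φ with
  | bot => rfl
  | top => rfl
  | box x φ => simp only [subM, mval, mvVal_subFml]
  | bbox b Φ ih => simp only [subM, mval, ih]
  | and Φ Ψ ihΦ ihΨ => simp only [subM, mval, ihΦ, ihΨ]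
  | or Φ Ψ ihΦ ihΨ => simp only [subM, mval, ihΦ, ihΨ]

/-- Theorems of `G` with the substitution rule are tautologies. -/
theorem thms_with_subst_are_tautologies [Fintype X] [DecidableEq X]
    (su : U → X → X) (bo : B → X → X → X) (Φ Ψ : MFml X H U B)
    (h : DerivS su bo (∅ : Set (MFml X H U B × MFml X H U B)) Φ Ψ) :
    ∀ v : H → X, mval su bo v Φ ≤ mval su bo v Ψ := by
  induction h with
  | hyp h => exact h.elim
  | refl Φ => exact fun v => le_rfl
  | top Φ => exact fun v => le_top
  | bot Φ => exact fun v => bot_le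
  | andE1 Φ Ψ => exact fun v => inf_le_left
  | andE2 Φ Ψ => exact fun v => inf_le_right
  | orI1 Φ Ψ => exact fun v => le_sup_left
  | orI2 Φ Ψ => exact fun v => le_sup_right
  | distrib Φ Ψ Υ => exact fun v => (inf_sup_left _ _ _).le
  | introBoolAnd b Φ Ψ => exact fun v => (mval_boolDisj su bo v _ b Φ Ψ).le
  | introBoolOr b Φ Ψ => exact fun v => (mval_boolDisj su bo v _ b Φ Ψ).le
  | introUn x u φ => exact fun v => (mval_unDisj su bo v x u φ).le
  | introBin x c φ ψ => exact fun v => (mval_binDisj su bo v x c φ ψ).le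
  | elimBoolAnd b Φ Ψ => exact fun v => (mval_boolDisj su bo v _ b Φ Ψ).ge
  | elimBoolOr b Φ Ψ => exact fun v => (mval_boolDisj su bo v _ b Φ Ψ).ge
  | elimUn x u φ => exact fun v => (mval_unDisj su bo v x u φ).ge
  | elimBin x c φ ψ => exact fun v => (mval_binDisj su bo v x c φ ψ).ge
  | cut _ _ ih₁ ih₂ => exact fun v => (ih₁ v).trans (ih₂ v)
  | lowerBound _ _ ih₁ ih₂ => exact fun v => le_inf (ih₁ v) (ih₂ v)
  | upperBound _ _ ih₁ ih₂ => exact fun v => sup_le (ih₁ v) (ih₂ v)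
  | subst σ _ ih =>
    intro v
    rw [mval_subM, mval_subM]
    exact ih _
end

section
/- All axioms of the Gentzen system G are tautologies: for every many-valued valuation v and every instance of the axioms of G (reflexivity Φ ⊢ Φ; top/bottom Φ ⊢ 1 and 0 ⊢ Φ; meet projections Φ ∧ Ψ ⊢ Φ and Φ ∧ Ψ ⊢ Ψ; join injections Φ ⊢ Φ ∨ Ψ and Φ ⊢ Ψ ∨ Φ; distributivity Φ ∧ (Ψ ∨ Υ) ⊢ (Φ ∧ Ψ) ∨ (Φ ∧ Υ); and all introduction and elimination axioms for the many-valued and Boolean connectives), the valuation v satisfies that axiom sequent, i.e. the 𝔉(v)-value of the left side is ≤ the 𝔉(v)-value of the right side. -/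
variable {X H U B : Type}

theorem mval_bigOr_filter [DecidableEq X] {ι : Type} [Fintype ι] (su : U → X → X)
    (bo : B → X → X → X) (v : H → X) (p : ι → Prop) [DecidablePred p] (f : ι → MFml X H U B) :
    mval su bo v (bigOr ((Finset.univ.filter p).toList.map f)) = true ↔
      ∃ i, p i ∧ mval su bo v (f i) = true := by
  simp [mval_bigOr]

/-- All axioms of the Gentzen system `G` are tautologies. -/
theorem axioms_are_tautologies [Fintype X] [DecidableEq X]
    (su : U → X → X) (bo : B → X → X → X) (v : H → X) :
    (∀ Φ : MFml X H U B, mval su bo v Φ ≤ mval su bo v Φ) ∧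
    (∀ Φ : MFml X H U B, mval su bo v Φ ≤ mval su bo v .top) ∧
    (∀ Φ : MFml X H U B, mval su bo v .bot ≤ mval su bo v Φ) ∧
    (∀ Φ Ψ : MFml X H U B, mval su bo v (.and Φ Ψ) ≤ mval su bo v Φ) ∧
    (∀ Φ Ψ : MFml X H U B, mval su bo v (.and Φ Ψ) ≤ mval su bo v Ψ) ∧
    (∀ Φ Ψ : MFml X H U B, mval su bo v Φ ≤ mval su bo v (.or Φ Ψ)) ∧
    (∀ Φ Ψ : MFml X H U B, mval su bo v Φ ≤ mval su bo v (.or Ψ Φ)) ∧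
    (∀ Φ Ψ Υ : MFml X H U B,
      mval su bo v (.and Φ (.or Ψ Υ)) ≤ mval su bo v (.or (.and Φ Ψ) (.and Φ Υ))) ∧
    (∀ (b : Bool) (Φ Ψ : MFml X H U B),
      mval su bo v (boolDisj (· && ·) b Φ Ψ) ≤ mval su bo v (.bbox b (.and Φ Ψ))) ∧
    (∀ (b : Bool) (Φ Ψ : MFml X H U B),
      mval su bo v (boolDisj (· || ·) b Φ Ψ) ≤ mval su bo v (.bbox b (.or Φ Ψ))) ∧
    (∀ (x : X) (u : U) (φ : Fml H U B),
      mval su bo v (unDisj su x u φ) ≤ mval su bo v (.box x (.un u φ))) ∧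
    (∀ (x : X) (c : B) (φ ψ : Fml H U B),
      mval su bo v (binDisj bo x c φ ψ) ≤ mval su bo v (.box x (.bin c φ ψ))) ∧
    (∀ (b : Bool) (Φ Ψ : MFml X H U B),
      mval su bo v (.bbox b (.and Φ Ψ)) ≤ mval su bo v (boolDisj (· && ·) b Φ Ψ)) ∧
    (∀ (b : Bool) (Φ Ψ : MFml X H U B),
      mval su bo v (.bbox b (.or Φ Ψ)) ≤ mval su bo v (boolDisj (· || ·) b Φ Ψ)) ∧
    (∀ (x : X) (u : U) (φ : Fml H U B),
      mval su bo v (.box x (.un u φ)) ≤ mval su bo v (unDisj su x u φ)) ∧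
    (∀ (x : X) (c : B) (φ ψ : Fml H U B),
      mval su bo v (.box x (.bin c φ ψ)) ≤ mval su bo v (binDisj bo x c φ ψ)) := by
  refine ⟨fun _ => le_rfl, fun _ => Bool.le_true _, fun _ => Bool.false_le _,
    fun _ _ => Bool.and_le_left _ _, fun _ _ => Bool.and_le_right _ _,
    fun _ _ => Bool.left_le_or _ _, fun _ _ => Bool.right_le_or _ _,
    fun _ _ _ => (Bool.and_or_distrib_left _ _ _).le,
    fun _ _ _ => (mval_boolDisj ..).le, fun _ _ _ => (mval_boolDisj ..).le,
    fun _ _ _ => (mval_unDisj ..).le, fun _ _ _ _ => (mval_binDisj ..).le,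
    fun _ _ _ => (mval_boolDisj ..).ge, fun _ _ _ => (mval_boolDisj ..).ge,
    fun _ _ _ => (mval_unDisj ..).ge, fun _ _ _ _ => (mval_binDisj ..).ge⟩
end

section
/- Satisfaction of the canonical reduct characterizes the truth value (Proposition 3 of the paper): for every many-valued valuation v, every x ∈ X and every formula φ ∈ L, the canonical reduct of [x]φ is satisfied by v, i.e. 𝔉(v)(reduct of [x]φ) = 1, if and only if x = v(φ). -/
variable {X H U B : Type}

/-- Satisfaction of the canonical reduct characterizes the truth
value. -/
theorem reduct_satisfied_iff [Fintype X] [DecidableEq X]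
    (su : U → X → X) (bo : B → X → X → X) :
    ∀ (v : H → X) (x : X) (φ : Fml H U B),
      mval su bo v (reduct su bo φ x) = true ↔ x = mvVal su bo v φ := by
  intro v x φ
  induction φ generalizing x with
  | atom A => simp [reduct, mval, mvVal, eq_comm]
  | un u φ ih => simp [reduct, mvVal, mval_bigOr, ih]
  | bin c φ ψ ihφ ihψ => simp [reduct, mval, mvVal, mval_bigOr, ihφ, ihψ]
end

section
/- Derivable disjunctive normal form in G: for every formula Φ ∈ L_M with no nested modal operators there exists a formula D that is a finite disjunction of finite conjunctions of modal atoms [x]A with x ∈ X and A ∈ H (with the empty disjunction taken to be 0 and the empty conjunction taken to be 1) such that both sequents Φ ⊢ D and D ⊢ Φ are derivable in G from the empty set of assumptions. -/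
variable {X H U B : Type}

namespace Deriv

variable [Fintype X] [DecidableEq X] {su : U → X → X} {bo : B → X → X → X}
  {Γ : Set (MFml X H U B × MFml X H U B)} {Φ Φ' Ψ Ψ' Υ : MFml X H U B}
  {l : List (MFml X H U B)}

theorem and_mono (h₁ : Deriv su bo Γ Φ Φ') (h₂ : Deriv su bo Γ Ψ Ψ') :
    Deriv su bo Γ (.and Φ Ψ) (.and Φ' Ψ') :=
  lowerBound (cut (andE1 _ _) h₁) (cut (andE2 _ _) h₂)

theorem or_mono (h₁ : Deriv su bo Γ Φ Φ') (h₂ : Deriv su bo Γ Ψ Ψ') :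
    Deriv su bo Γ (.or Φ Ψ) (.or Φ' Ψ') :=
  upperBound (cut h₁ (orI1 _ _)) (cut h₂ (orI2 _ _))

theorem and_comm (Φ Ψ : MFml X H U B) : Deriv su bo Γ (.and Φ Ψ) (.and Ψ Φ) :=
  lowerBound (andE2 _ _) (andE1 _ _)

theorem to_bigOr (h : Φ ∈ l) : Deriv su bo Γ Φ (bigOr l) := by
  induction l with
  | nil => simp at h
  | cons Ψ l ih =>
    rcases List.mem_cons.1 h with rfl | h
    · exact orI1 _ _
    · exact cut (ih h) (orI2 _ _)

theorem bigOr_le (h : ∀ Φ ∈ l, Deriv su bo Γ Φ Ψ) : Deriv su bo Γ (bigOr l) Ψ := by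
  induction l with
  | nil => exact bot _
  | cons Φ l ih =>
    rw [List.forall_mem_cons] at h
    exact upperBound h.1 (ih h.2)

theorem and_bigOr_le (h : ∀ Ψ ∈ l, Deriv su bo Γ (.and Φ Ψ) Υ) :
    Deriv su bo Γ (.and Φ (bigOr l)) Υ := by
  induction l with
  | nil => exact cut (andE2 _ _) (bot _)
  | cons Ψ l ih =>
    rw [List.forall_mem_cons] at h
    exact cut (distrib _ _ _) (upperBound h.1 (ih h.2))

theorem bigOr_and_bigOr_le {l' : List (MFml X H U B)}
    (h : ∀ Φ ∈ l, ∀ Ψ ∈ l', Deriv su bo Γ (.and Φ Ψ) Υ) :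
    Deriv su bo Γ (.and (bigOr l) (bigOr l')) Υ :=
  and_bigOr_le fun Ψ hΨ => cut (and_comm _ _) <| and_bigOr_le fun Φ hΦ =>
    cut (and_comm _ _) (h Φ hΦ Ψ hΨ)

theorem bigAnd_le (h : Φ ∈ l) : Deriv su bo Γ (bigAnd l) Φ := by
  induction l with
  | nil => simp at h
  | cons Ψ l ih =>
    rcases List.mem_cons.1 h with rfl | h
    · exact andE1 _ _
    · exact cut (andE2 _ _) (ih h)

theorem to_bigAnd (h : ∀ Ψ ∈ l, Deriv su bo Γ Φ Ψ) : Deriv su bo Γ Φ (bigAnd l) := by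
  induction l with
  | nil => exact top _
  | cons Ψ l ih =>
    rw [List.forall_mem_cons] at h
    exact lowerBound h.1 (ih h.2)

theorem bigAnd_append (l l' : List (MFml X H U B)) :
    Deriv su bo Γ (.and (bigAnd l) (bigAnd l')) (bigAnd (l ++ l')) :=
  to_bigAnd fun _ h => (List.mem_append.1 h).elim
    (fun h => cut (andE1 _ _) (bigAnd_le h)) fun h => cut (andE2 _ _) (bigAnd_le h)

theorem append_bigAnd (l l' : List (MFml X H U B)) :
    Deriv su bo Γ (bigAnd (l ++ l')) (.and (bigAnd l) (bigAnd l')) :=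
  lowerBound (to_bigAnd fun _ h => bigAnd_le (List.mem_append_left _ h))
    (to_bigAnd fun _ h => bigAnd_le (List.mem_append_right _ h))

end Deriv

/-- The conjunction of the modal atoms `[x]A` for `(x, A)` in `c`. -/
abbrev atomConj (c : List (X × H)) : MFml X H U B :=
  bigAnd (c.map fun p => .box p.1 (.atom p.2))

/-- `Φ` is interderivable in `G` with a disjunction of conjunctions of modal atoms `[x]A`. -/
def HasDNF [Fintype X] [DecidableEq X] (su : U → X → X) (bo : B → X → X → X)
    (Γ : Set (MFml X H U B × MFml X H U B)) (Φ : MFml X H U B) : Prop :=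
  ∃ LL : List (List (X × H)),
    Deriv su bo Γ Φ (bigOr (LL.map atomConj)) ∧ Deriv su bo Γ (bigOr (LL.map atomConj)) Φ

namespace HasDNF

open Deriv

variable [Fintype X] [DecidableEq X] {su : U → X → X} {bo : B → X → X → X}
  {Γ : Set (MFml X H U B × MFml X H U B)} {Φ Ψ : MFml X H U B}

theorem congr (h : HasDNF su bo Γ Φ) (h₁ : Deriv su bo Γ Ψ Φ) (h₂ : Deriv su bo Γ Φ Ψ) :
    HasDNF su bo Γ Ψ :=
  let ⟨LL, hl, hr⟩ := h
  ⟨LL, cut h₁ hl, cut hr h₂⟩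

theorem bot : HasDNF su bo Γ .bot := ⟨[], .refl _, .refl _⟩

theorem top : HasDNF su bo Γ .top := ⟨[[]], orI1 _ _, .top _⟩

theorem box_atom (x : X) (A : H) : HasDNF su bo Γ (.box x (.atom A)) :=
  ⟨[[(x, A)]], cut (lowerBound (.refl _) (.top _)) (orI1 _ _),
    upperBound (andE1 _ _) (.bot _)⟩

theorem or (hΦ : HasDNF su bo Γ Φ) (hΨ : HasDNF su bo Γ Ψ) : HasDNF su bo Γ (.or Φ Ψ) := by
  obtain ⟨L, hL, hL'⟩ := hΦ
  obtain ⟨M, hM, hM'⟩ := hΨ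
  refine ⟨L ++ M, ?_, ?_⟩ <;> rw [List.map_append]
  · exact upperBound (cut hL (bigOr_le fun _ h => to_bigOr (List.mem_append_left _ h)))
      (cut hM (bigOr_le fun _ h => to_bigOr (List.mem_append_right _ h)))
  · exact cut (bigOr_le fun _ h => (List.mem_append.1 h).elim
      (fun h => cut (to_bigOr h) (orI1 _ _)) fun h => cut (to_bigOr h) (orI2 _ _))
      (or_mono hL' hM')

theorem and (hΦ : HasDNF su bo Γ Φ) (hΨ : HasDNF su bo Γ Ψ) : HasDNF su bo Γ (.and Φ Ψ) := by
  obtain ⟨L, hL, hL'⟩ := hΦ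
  obtain ⟨M, hM, hM'⟩ := hΨ
  refine ⟨(L ×ˢ M).map fun p => p.1 ++ p.2, cut (and_mono hL hM) (bigOr_and_bigOr_le ?_),
    cut (bigOr_le ?_) (and_mono hL' hM')⟩
  · simp only [List.forall_mem_map]
    intro c hc d hd
    refine cut (bigAnd_append _ _) ?_
    rw [← List.map_append]
    exact to_bigOr (List.mem_map_of_mem
      (List.mem_map.2 ⟨(c, d), List.mem_product.2 ⟨hc, hd⟩, rfl⟩))
  · simp only [List.forall_mem_map]
    rintro ⟨c, d⟩ hcd
    obtain ⟨hc, hd⟩ := List.mem_product.1 hcd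
    rw [atomConj, List.map_append]
    exact cut (append_bigAnd _ _)
      (and_mono (to_bigOr (List.mem_map_of_mem hc)) (to_bigOr (List.mem_map_of_mem hd)))

theorem bigOr {l : List (MFml X H U B)} (h : ∀ Φ ∈ l, HasDNF su bo Γ Φ) :
    HasDNF su bo Γ (bigOr l) := by
  induction l with
  | nil => exact bot
  | cons Φ l ih =>
    rw [List.forall_mem_cons] at h
    exact or h.1 (ih h.2)

theorem box (φ : Fml H U B) (x : X) : HasDNF su bo Γ (.box x φ) := by
  induction φ generalizing x with
  | atom A => exact box_atom x A
  | un u φ ih =>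
    exact congr (bigOr (List.forall_mem_map.2 fun y _ => ih y)) (elimUn x u φ) (introUn x u φ)
  | bin c φ ψ ih₁ ih₂ =>
    exact congr (bigOr (List.forall_mem_map.2 fun p _ => and (ih₁ p.1) (ih₂ p.2)))
      (elimBin x c φ ψ) (introBin x c φ ψ)

end HasDNF

/-- Derivable disjunctive normal form in `G` for formulas with no
nested modal operators. -/
theorem derivable_dnf [Fintype X] [DecidableEq X]
    (su : U → X → X) (bo : B → X → X → X) (Φ : MFml X H U B) (h : NoNest Φ) :
    ∃ LL : List (List (X × H)),
      Deriv su bo (∅ : Set (MFml X H U B × MFml X H U B)) Φ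
        (bigOr (LL.map fun c => bigAnd (c.map fun p => MFml.box p.1 (Fml.atom p.2)))) ∧
      Deriv su bo (∅ : Set (MFml X H U B × MFml X H U B))
        (bigOr (LL.map fun c => bigAnd (c.map fun p => MFml.box p.1 (Fml.atom p.2))))
        Φ := by
  induction h with
  | bot => exact HasDNF.bot
  | top => exact HasDNF.top
  | box x φ => exact HasDNF.box φ x
  | and _ _ ih₁ ih₂ => exact HasDNF.and ih₁ ih₂
  | or _ _ ih₁ ih₂ => exact HasDNF.or ih₁ ih₂
end
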